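/- Let $0<t<s<d$ and $R>0$. There exists a constant $C=C(s,t,d,R)>0$ such that for every Lebesgue measurable set $E\subset B(0,R)\subset\mathbb{R}^d$ with the property that every point of $E$ has positive Lebesgue density with respect to $E$, one has $\mathcal{H}_\infty^s(E) \le C\, G_t(E)$, where $G_t(E) := \sup\{\mathcal{L}(F)^2/I_t(F) : F\subset E \text{ Lebesgue measurable, } \mathcal{L}(F)>0\}$. -/

import Mathlib

open MeasureTheory Filter Set
open scoped ENNReal NNReal

/-- The `s`-dimensional Hausdorff content of a set. -/
noncomputable def hContent {X : Type*} [EMetricSpace X] (s : ℝ) (F : Set X) : ℝ≥0∞ :=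
  ⨅ (C : ℕ → Set X) (_ : F ⊆ ⋃ n, C n), ∑' n, EMetric.diam (C n) ^ s

/-- The `t`-energy of a measure: `∬ |x-y|^{-t} dμ dμ`. -/
noncomputable def energy {X : Type*} [EMetricSpace X] [MeasurableSpace X] (t : ℝ)
    (μ : Measure X) : ℝ≥0∞ :=
  ∫⁻ x, ∫⁻ y, edist x y ^ (-t) ∂μ ∂μ

/-- `G_t(E) = sup { L(F)²/I_t(F) : F ⊆ E Lebesgue measurable, L(F) > 0 }`. -/
noncomputable def Gsup {d : ℕ} (t : ℝ) (E : Set (EuclideanSpace ℝ (Fin d))) : ℝ≥0∞ :=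
  ⨆ (F : Set (EuclideanSpace ℝ (Fin d)))
    (_ : MeasurableSet F ∧ F ⊆ E ∧ 0 < volume F),
    volume F ^ 2 / energy t (volume.restrict F)

section Aux

/-- dyadic side length -/
noncomputable def ell (n : ℕ) : ℝ≥0∞ := (2⁻¹ : ℝ≥0∞) ^ n

noncomputable def idx {d : ℕ} (n : ℕ) (x : EuclideanSpace ℝ (Fin d)) : Fin d → ℤ :=
  fun i => ⌊(2:ℝ) ^ n * x i⌋

def cell {d : ℕ} (n : ℕ) (z : Fin d → ℤ) : Set (EuclideanSpace ℝ (Fin d)) := {x | idx n x = z}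

lemma ell_ne_zero (n : ℕ) : ell n ≠ 0 := by
  unfold ell; exact pow_ne_zero _ (by simp)

lemma ell_ne_top (n : ℕ) : ell n ≠ ⊤ := by
  unfold ell; exact ENNReal.pow_ne_top (by simp)

lemma ell_anti {n m : ℕ} (h : n ≤ m) : ell m ≤ ell n := by
  unfold ell; exact pow_le_pow_of_le_one (by simp) (by simp) h

lemma ell_add (n m : ℕ) : ell (n + m) = ell n * ell m := by
  unfold ell; exact pow_add _ _ _

lemma ell_eq_ofReal (n : ℕ) : ell n = ENNReal.ofReal ((2⁻¹:ℝ) ^ n) := by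
  unfold ell
  rw [ENNReal.ofReal_pow (by norm_num), ENNReal.ofReal_inv_of_pos (by norm_num)]; simp

lemma ell_rpow_anti {n m : ℕ} (h : n ≤ m) {s : ℝ} (hs : 0 ≤ s) : ell m ^ s ≤ ell n ^ s :=
  ENNReal.rpow_le_rpow (ell_anti h) hs

lemma ell_rpow_mono {n m : ℕ} (h : n ≤ m) {s : ℝ} (hs : s ≤ 0) : ell n ^ s ≤ ell m ^ s := by
  have := ell_rpow_anti h (s := -s) (by linarith)
  rw [ENNReal.rpow_neg, ENNReal.rpow_neg] at this
  exact ENNReal.inv_le_inv.mp this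

lemma ell_rpow_add (n : ℕ) (a b : ℝ) : ell n ^ (a + b) = ell n ^ a * ell n ^ b :=
  ENNReal.rpow_add _ _ (ell_ne_zero n) (ell_ne_top n)

lemma ell_rpow_ne_top (n : ℕ) (a : ℝ) : ell n ^ a ≠ ⊤ :=
  ENNReal.rpow_ne_top_of_ne_zero (ell_ne_zero n) (ell_ne_top n)

lemma ell_rpow_ne_zero (n : ℕ) (a : ℝ) : ell n ^ a ≠ 0 := by
  simp [ENNReal.rpow_eq_zero_iff, ell_ne_zero, ell_ne_top]

lemma ell_rpow_eq (n : ℕ) (a : ℝ) : ell n ^ a = ((2⁻¹ : ℝ≥0∞) ^ a) ^ n := by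
  unfold ell
  rw [← ENNReal.rpow_natCast, ← ENNReal.rpow_mul, mul_comm, ENNReal.rpow_mul, ENNReal.rpow_natCast]

lemma tendsto_ell_rpow {a : ℝ} (ha : 0 < a) : Tendsto (fun n => ell n ^ a) atTop (nhds 0) := by
  simp_rw [ell_rpow_eq]
  apply ENNReal.tendsto_pow_atTop_nhds_zero_of_lt_one
  exact ENNReal.rpow_lt_one (by simp) ha

variable {d : ℕ}

lemma measurable_idx (n : ℕ) : Measurable (idx (d := d) n) := by
  unfold idx
  refine measurable_pi_lambda _ fun i => ?_
  exact Int.measurable_floor.comp (by fun_prop)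

lemma measurableSet_cell (n : ℕ) (z : Fin d → ℤ) : MeasurableSet (cell n z) :=
  measurable_idx n (measurableSet_singleton z)

lemma mem_cell_idx (n : ℕ) (x : EuclideanSpace ℝ (Fin d)) : x ∈ cell n (idx n x) := rfl

lemma idx_nest {n m : ℕ} (h : n ≤ m) {x y : EuclideanSpace ℝ (Fin d)} (hxy : idx m x = idx m y) :
    idx n x = idx n y := by
  have key : ∀ x : EuclideanSpace ℝ (Fin d), ∀ i, idx n x i = idx m x i / ((2 ^ (m - n) : ℕ) : ℤ) := by
    intro x i
    unfold idx
    rw [← Int.floor_div_natCast]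
    congr 1
    obtain ⟨k, rfl⟩ := Nat.exists_eq_add_of_le h
    simp only [Nat.add_sub_cancel_left]
    push_cast
    rw [pow_add]; field_simp
  ext i
  rw [key, key, hxy]

lemma cell_subset {n m : ℕ} (h : n ≤ m) {z w : Fin d → ℤ} {x : EuclideanSpace ℝ (Fin d)}
    (hx : x ∈ cell n z) (hx' : x ∈ cell m w) : cell m w ⊆ cell n z := by
  intro y hy
  change idx n y = z
  rw [← (show idx n x = z from hx)]
  apply idx_nest h
  rw [show idx m y = w from hy, show idx m x = w from hx']

lemma volume_cell_le (n : ℕ) (z : Fin d → ℤ) : volume (cell n z) ≤ ell n ^ (d : ℝ) := by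
  have h2 : (0:ℝ) < 2 ^ n := by positivity
  have : cell n z ⊆ (MeasurableEquiv.toLp 2 (Fin d → ℝ)).symm ⁻¹'
      (Set.pi univ fun i => Ico ((z i : ℝ) / 2 ^ n) (((z i : ℝ) + 1) / 2 ^ n)) := by
    intro x hx i _
    have hi : ⌊(2:ℝ) ^ n * x i⌋ = z i := congrFun hx i
    rw [Int.floor_eq_iff] at hi
    constructor
    · rw [div_le_iff₀ h2]; have := hi.1; simp; linarith
    · rw [lt_div_iff₀ h2]; have := hi.2; simp; linarith
  refine (measure_mono this).trans ?_
  rw [(EuclideanSpace.volume_preserving_symm_measurableEquiv_toLp (Fin d)).measure_preimage_equiv,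
    Real.volume_pi_Ico]
  have : ∀ i, ENNReal.ofReal (((z i : ℝ) + 1) / 2 ^ n - (z i : ℝ) / 2 ^ n) = ell n := by
    intro i
    rw [ell_eq_ofReal]; congr 1; rw [inv_pow]; field_simp; ring
  simp [this, ENNReal.rpow_natCast]

lemma edist_le_of_coord {x y : EuclideanSpace ℝ (Fin d)} {a : ℝ} (ha : 0 ≤ a)
    (h : ∀ i, |x i - y i| ≤ a) : edist x y ≤ ENNReal.ofReal (d * a) := by
  rw [edist_dist]
  apply ENNReal.ofReal_le_ofReal
  rw [EuclideanSpace.dist_eq]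
  apply Real.sqrt_le_iff.mpr ⟨by positivity, ?_⟩
  have : ∀ i ∈ (Finset.univ : Finset (Fin d)), dist (x i) (y i) ^ 2 ≤ a ^ 2 := by
    intro i _
    rw [Real.dist_eq]
    exact pow_le_pow_left₀ (abs_nonneg _) (h i) 2
  refine (Finset.sum_le_sum this).trans ?_
  simp only [Finset.sum_const, Finset.card_univ, Fintype.card_fin, nsmul_eq_mul]
  rw [mul_pow]
  apply mul_le_mul_of_nonneg_right _ (by positivity)
  rcases Nat.eq_zero_or_pos d with h0 | h0
  · simp [h0]
  · have : (1:ℝ) ≤ d := by exact_mod_cast h0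
    nlinarith

/-- neighbours -/
noncomputable def nbr (d : ℕ) : Finset (Fin d → ℤ) := Fintype.piFinset fun _ => Finset.Icc (-1) 1

lemma nbr_card_pos : (nbr d).Nonempty := ⟨0, by simp [nbr]⟩

lemma edist_le_of_nbr {n : ℕ} {w : Fin d → ℤ} (hw : w ∈ nbr d) {x y : EuclideanSpace ℝ (Fin d)}
    (hy : y ∈ cell n (idx n x + w)) : edist x y ≤ (2 * d : ℕ) * ell n := by
  have h2 : (0:ℝ) < 2 ^ n := by positivity
  have := edist_le_of_coord (x := x) (y := y) (a := 2 * (2⁻¹) ^ n) (by positivity) (by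
    intro i
    have hi : ⌊(2:ℝ) ^ n * y i⌋ = ⌊(2:ℝ) ^ n * x i⌋ + w i := congrFun hy i
    have hwi : -1 ≤ w i ∧ w i ≤ 1 := by
      have := Fintype.mem_piFinset.mp hw i
      simpa using this
    have a1 := Int.floor_le ((2:ℝ) ^ n * y i)
    have a2 := Int.lt_floor_add_one ((2:ℝ) ^ n * y i)
    have a3 := Int.floor_le ((2:ℝ) ^ n * x i)
    have a4 := Int.lt_floor_add_one ((2:ℝ) ^ n * x i)
    rw [hi] at a1 a2
    push_cast at a1 a2
    have b1 : (-1:ℝ) ≤ w i := by exact_mod_cast hwi.1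
    have b2 : (w i:ℝ) ≤ 1 := by exact_mod_cast hwi.2
    rw [inv_pow, ← div_eq_mul_inv, le_div_iff₀ h2, ← abs_of_pos h2, ← abs_mul, abs_le]
    constructor <;> nlinarith)
  refine this.trans (le_of_eq ?_)
  rw [ell_eq_ofReal, ← ENNReal.ofReal_natCast, ← ENNReal.ofReal_mul (by positivity)]
  congr 1; push_cast; ring

lemma edist_le_of_cell {n : ℕ} {z : Fin d → ℤ} {x y : EuclideanSpace ℝ (Fin d)}
    (hx : x ∈ cell n z) (hy : y ∈ cell n z) : edist x y ≤ (2 * d : ℕ) * ell n := by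
  refine edist_le_of_nbr (w := 0) (by simp [nbr]) ?_
  rw [show idx n x = z from hx]; simpa using hy

lemma ball_subset_nbr (n : ℕ) (x : EuclideanSpace ℝ (Fin d)) :
    Metric.ball x ((2⁻¹:ℝ) ^ n) ⊆ ⋃ w ∈ nbr d, cell n (idx n x + w) := by
  intro y hy
  have h2 : (0:ℝ) < 2 ^ n := by positivity
  have hc : ∀ i, |y i - x i| < (2⁻¹) ^ n := fun i => by
    have h1 := PiLp.norm_apply_le (y - x) i
    rw [Metric.mem_ball, dist_eq_norm] at hy
    simp only [PiLp.sub_apply, Real.norm_eq_abs] at h1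
    exact h1.trans_lt hy
  simp only [mem_iUnion, exists_prop]
  refine ⟨idx n y - idx n x, ?_, ?_⟩
  · refine Fintype.mem_piFinset.mpr fun i => ?_
    have h := hc i
    rw [inv_pow, ← one_div, lt_div_iff₀ h2, ← abs_of_pos h2, ← abs_mul, abs_lt] at h
    have a1 := Int.floor_le ((2:ℝ) ^ n * y i)
    have a2 := Int.lt_floor_add_one ((2:ℝ) ^ n * y i)
    have a3 := Int.floor_le ((2:ℝ) ^ n * x i)
    have a4 := Int.lt_floor_add_one ((2:ℝ) ^ n * x i)
    simp only [Pi.sub_apply, idx, Finset.mem_Icc]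
    have c1 : (⌊(2:ℝ) ^ n * y i⌋ : ℝ) - ⌊(2:ℝ) ^ n * x i⌋ < 2 := by linarith [h.1, h.2]
    have c2 : (-2 : ℝ) < (⌊(2:ℝ) ^ n * y i⌋ : ℝ) - ⌊(2:ℝ) ^ n * x i⌋ := by linarith [h.1, h.2]
    have c1' : ⌊(2:ℝ) ^ n * y i⌋ - ⌊(2:ℝ) ^ n * x i⌋ < 2 := by exact_mod_cast c1
    have c2' : -2 < ⌊(2:ℝ) ^ n * y i⌋ - ⌊(2:ℝ) ^ n * x i⌋ := by exact_mod_cast c2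
    constructor <;> linarith
  · change idx n y = _
    simp

/-- Admissible (Frostman) measures on `E` with bounded density. -/
def Adm (E : Set (EuclideanSpace ℝ (Fin d))) (s : ℝ) (μ : Measure (EuclideanSpace ℝ (Fin d))) :
    Prop :=
  (∃ c : ℝ≥0, μ ≤ c • volume.restrict E) ∧ ∀ n z, μ (cell n z) ≤ ell n ^ s

noncomputable def MM (E : Set (EuclideanSpace ℝ (Fin d))) (s : ℝ)
    (P : Set (EuclideanSpace ℝ (Fin d))) : ℝ≥0∞ :=
  ⨆ μ : {μ // Adm E s μ}, μ.1 P

def Sat (E : Set (EuclideanSpace ℝ (Fin d))) (s : ℝ) (n : ℕ) (z : Fin d → ℤ) : Prop :=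
  MM E s (cell n z) = ell n ^ s

/-- no strict ancestor is saturated -/
def Fr (E : Set (EuclideanSpace ℝ (Fin d))) (s : ℝ) (n : ℕ) (z : Fin d → ℤ) : Prop :=
  ∀ x ∈ cell n z, ∀ m < n, ¬ Sat E s m (idx m x)

variable {E : Set (EuclideanSpace ℝ (Fin d))} {s : ℝ}

lemma adm_zero : Adm E s 0 := ⟨⟨0, by simp⟩, by simp⟩

instance : Nonempty {μ // Adm E s μ} := ⟨⟨0, adm_zero⟩⟩

lemma MM_cell_le (n : ℕ) (z : Fin d → ℤ) : MM E s (cell n z) ≤ ell n ^ s :=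
  iSup_le fun μ => μ.2.2 n z

lemma le_MM {μ : Measure (EuclideanSpace ℝ (Fin d))} (h : Adm E s μ) (P) : μ P ≤ MM E s P :=
  le_iSup (fun μ : {μ // Adm E s μ} => μ.1 P) ⟨μ, h⟩

lemma sum_iSup_le {α ι : Type*} [Nonempty ι] (f : α → ι → ℝ≥0∞) (c : ℝ≥0∞) (B : Finset α) :
    ∀ b : ℝ≥0∞, (∀ g : α → ι, b + ∑ a ∈ B, f a (g a) ≤ c) → b + ∑ a ∈ B, ⨆ i, f a i ≤ c := by
  classical
  induction B using Finset.induction_on with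
  | empty => intro b h; simpa using h (fun _ => Classical.arbitrary ι)
  | insert a B ha ih =>
    intro b h
    rw [Finset.sum_insert ha, ← add_assoc, ENNReal.add_iSup, ENNReal.iSup_add]
    refine iSup_le fun i => ih _ fun g => ?_
    have := h (Function.update g a i)
    rw [Finset.sum_insert ha] at this
    simp only [Function.update_self] at this
    rw [Finset.sum_congr rfl (g := fun x => f x (g x)), ← add_assoc] at this
    · exact this
    · intro x hx
      rw [Function.update_of_ne (by rintro rfl; exact ha hx)]

lemma adm_glue (hs : 0 < s) (A : Finset (ℕ × (Fin d → ℤ)))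
    (hdis : ∀ a ∈ A, ∀ b ∈ A, ∀ x, x ∈ cell a.1 a.2 → x ∈ cell b.1 b.2 → a = b)
    (hfr : ∀ a ∈ A, Fr E s a.1 a.2)
    (g : ℕ × (Fin d → ℤ) → {μ // Adm E s μ}) :
    Adm E s (∑ a ∈ A, (g a).1.restrict (cell a.1 a.2)) := by
  set μ := ∑ a ∈ A, (g a).1.restrict (cell a.1 a.2) with hμ
  have hb : ∃ c : ℝ≥0, μ ≤ c • volume.restrict E := by
    choose c hc using fun a => (g a).2.1
    refine ⟨∑ a ∈ A, c a, ?_⟩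
    rw [hμ, Finset.sum_smul]
    exact Finset.sum_le_sum fun a _ => Measure.restrict_le_self.trans (hc a)
  have happ : ∀ S, μ S = ∑ a ∈ A, (g a).1 (S ∩ cell a.1 a.2) := by
    intro S
    simp [hμ, Measure.restrict_apply' (measurableSet_cell _ _)]
  refine ⟨hb, ?_⟩
  -- a bad cell strictly contains a member
  have hbad : ∀ m w, ell m ^ s < μ (cell m w) →
      ∃ a ∈ A, m < a.1 ∧ ∃ x ∈ cell a.1 a.2, x ∈ cell m w := by
    intro m w h
    by_contra! hcon
    apply h.not_ge
    by_cases hex : ∃ a ∈ A, ∃ x ∈ cell a.1 a.2, x ∈ cell m w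
    · obtain ⟨a, ha, x, hxa, hx⟩ := hex
      have hle : a.1 ≤ m := by
        by_contra! hlt
        exact hcon a ha hlt x hxa hx
      have hsub := cell_subset hle hxa hx
      rw [happ, Finset.sum_eq_single_of_mem a ha]
      · exact (measure_mono inter_subset_left).trans ((g a).2.2 m w)
      · intro b hb hne
        have : cell m w ∩ cell b.1 b.2 = ∅ := by
          ext y; simp only [mem_inter_iff, mem_empty_iff_false, iff_false, not_and]
          intro h1 h2
          exact hne (hdis b hb a ha y h2 (hsub h1))
        simp [this]
    · push Not at hex
      rw [happ, Finset.sum_eq_zero]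
      · exact zero_le
      · intro b hb
        have : cell m w ∩ cell b.1 b.2 = ∅ := by
          ext y; simp only [mem_inter_iff, mem_empty_iff_false, iff_false, not_and]
          intro h1 h2
          exact hex b hb y h2 h1
        simp [this]
  by_contra! hcon
  classical
  -- deepest bad level
  let Pm : ℕ → Prop := fun m => ∃ w, ell m ^ s < μ (cell m w)
  have hbd : ∀ m, Pm m → m ≤ A.sup Prod.fst := by
    rintro m ⟨w, hw⟩
    obtain ⟨a, ha, hlt, _⟩ := hbad m w hw
    exact hlt.le.trans (Finset.le_sup (f := Prod.fst) ha)
  obtain ⟨n, z, hnz⟩ := hcon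
  have hspec : Pm (Nat.findGreatest Pm (A.sup Prod.fst)) :=
    Nat.findGreatest_spec (m := n) (hbd n ⟨z, hnz⟩) ⟨z, hnz⟩
  set m := Nat.findGreatest Pm (A.sup Prod.fst) with hm
  obtain ⟨w, hw⟩ := hspec
  have hgood : ∀ k, m < k → ∀ v, μ (cell k v) ≤ ell k ^ s := by
    intro k hk v
    by_contra! h
    have := Nat.le_findGreatest (P := Pm) (hbd k ⟨v, h⟩) ⟨v, h⟩
    omega
  obtain ⟨a, ha, hlt, x, hxa, hx⟩ := hbad m w hw
  have hns := hfr a ha x hxa m hlt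
  rw [show idx m x = w from hx] at hns
  apply hns
  have hμ0 : μ (cell m w) ≠ 0 := (zero_le.trans_lt hw).ne'
  have hμt : μ (cell m w) ≠ ⊤ := by
    obtain ⟨c, hc⟩ := hb
    refine ((hc _).trans_lt ?_).ne
    rw [Measure.smul_apply]
    refine ENNReal.mul_lt_top (by simp) ?_
    refine (Measure.restrict_le_self _).trans_lt ?_
    exact (volume_cell_le _ _).trans_lt (ell_rpow_ne_top _ _).lt_top
  set θ := ell m ^ s / μ (cell m w) with hθ
  have hθ1 : θ ≤ 1 := ENNReal.div_le_of_le_mul (by simpa using hw.le)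
  have hθm : θ * μ (cell m w) = ell m ^ s := ENNReal.div_mul_cancel hμ0 hμt
  have hθt : θ ≠ ⊤ := (hθ1.trans_lt ENNReal.one_lt_top).ne
  have hadm : Adm E s (θ • μ.restrict (cell m w)) := by
    refine ⟨?_, ?_⟩
    · obtain ⟨c, hc⟩ := hb
      refine ⟨c, le_trans ?_ hc⟩
      intro S
      rw [Measure.smul_apply, smul_eq_mul]
      exact (mul_le_of_le_one_left zero_le hθ1).trans (Measure.restrict_le_self _)
    · intro k v
      rw [Measure.smul_apply, smul_eq_mul]
      rcases lt_or_ge m k with h | h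
      · exact (mul_le_of_le_one_left zero_le hθ1).trans
          ((Measure.restrict_le_self _).trans (hgood k h v))
      · refine le_trans ?_ (ell_rpow_anti h hs.le)
        rw [← hθm, Measure.restrict_apply' (measurableSet_cell _ _)]
        gcongr
        exact inter_subset_right
  refine le_antisymm (MM_cell_le _ _) ?_
  refine le_trans (le_of_eq ?_) (le_MM hadm (cell m w))
  rw [Measure.smul_apply, smul_eq_mul, Measure.restrict_apply_self, hθm]

lemma sum_MM_le (hs : 0 < s) (A : Finset (ℕ × (Fin d → ℤ)))
    (hdis : ∀ a ∈ A, ∀ b ∈ A, ∀ x, x ∈ cell a.1 a.2 → x ∈ cell b.1 b.2 → a = b)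
    (hfr : ∀ a ∈ A, Fr E s a.1 a.2) (P : Set (EuclideanSpace ℝ (Fin d)))
    (hP : ∀ a ∈ A, cell a.1 a.2 ⊆ P) :
    ∑ a ∈ A, MM E s (cell a.1 a.2) ≤ MM E s P := by
  have := sum_iSup_le (fun (a : ℕ × (Fin d → ℤ)) (μ : {μ // Adm E s μ}) => μ.1 (cell a.1 a.2))
    (MM E s P) A 0 (by
      intro g
      refine le_trans (le_of_eq ?_) (le_MM (adm_glue hs A hdis hfr g) P)
      simp only [zero_add, Measure.coe_finsetSum, Finset.sum_apply]
      refine Finset.sum_congr rfl fun a ha => ?_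
      rw [Measure.restrict_apply' (measurableSet_cell _ _), inter_eq_self_of_subset_right (hP a ha)])
  simpa [MM] using this

lemma tsum_MM_le (hs : 0 < s) (A : Set (ℕ × (Fin d → ℤ)))
    (hdis : ∀ a ∈ A, ∀ b ∈ A, ∀ x, x ∈ cell a.1 a.2 → x ∈ cell b.1 b.2 → a = b)
    (hfr : ∀ a ∈ A, Fr E s a.1 a.2) (P : Set (EuclideanSpace ℝ (Fin d)))
    (hP : ∀ a ∈ A, cell a.1 a.2 ⊆ P) :
    ∑' a : A, MM E s (cell a.1.1 a.1.2) ≤ MM E s P := by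
  rw [ENNReal.tsum_eq_iSup_sum]
  refine iSup_le fun B => ?_
  have := sum_MM_le hs (B.map (Function.Embedding.subtype _)) (E := E) (P := P) (by
    intro a ha b hb
    simp only [Finset.mem_map, Function.Embedding.subtype_apply, Subtype.exists,
      exists_and_right, exists_eq_right] at ha hb
    exact hdis a ha.1 b hb.1) (by
    intro a ha
    simp only [Finset.mem_map, Function.Embedding.subtype_apply, Subtype.exists,
      exists_and_right, exists_eq_right] at ha
    exact hfr a ha.1) (by
    intro a ha
    simp only [Finset.mem_map, Function.Embedding.subtype_apply, Subtype.exists,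
      exists_and_right, exists_eq_right] at ha
    exact hP a ha.1)
  simpa using this

lemma MM_ge (hs : 0 < s) (hsd : s < d) (n : ℕ) (z : Fin d → ℤ) :
    ell n ^ (s - d) * volume (E ∩ cell n z) ≤ MM E s (cell n z) := by
  have hadm : Adm E s ((ell n ^ (s - d)) • volume.restrict (cell n z ∩ E)) := by
    refine ⟨⟨(ell n ^ (s - d)).toNNReal, ?_⟩, ?_⟩
    · intro S
      simp only [Measure.smul_apply, Measure.nnreal_smul_coe_apply, smul_eq_mul,
        ENNReal.coe_toNNReal (ell_rpow_ne_top _ _)]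
      gcongr
      exact inter_subset_right
    · intro m w
      rw [Measure.smul_apply, smul_eq_mul]
      rcases le_or_gt n m with h | h
      · calc _ ≤ ell m ^ (s - d) * ell m ^ (d:ℝ) := by
              refine mul_le_mul' (ell_rpow_mono h (by linarith)) ?_
              exact (Measure.restrict_le_self _).trans (volume_cell_le _ _)
          _ = ell m ^ s := by rw [← ell_rpow_add]; congr 1; ring
      · calc _ ≤ ell n ^ (s - d) * ell n ^ (d:ℝ) := by
              gcongr
              refine (measure_mono (subset_univ _)).trans ?_
              rw [Measure.restrict_apply_univ]
              exact (measure_mono inter_subset_left).trans (volume_cell_le _ _)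
          _ = ell n ^ s := by rw [← ell_rpow_add]; congr 1; ring
          _ ≤ _ := ell_rpow_anti h.le hs.le
  refine le_trans (le_of_eq ?_) (le_MM hadm _)
  rw [Measure.smul_apply, smul_eq_mul, ← Measure.restrict_restrict (measurableSet_cell _ _),
    Measure.restrict_apply_self, Measure.restrict_apply (measurableSet_cell _ _), inter_comm]

/-- maximal saturated cells -/
def TT (E : Set (EuclideanSpace ℝ (Fin d))) (s : ℝ) : Set (ℕ × (Fin d → ℤ)) :=
  {a | Fr E s a.1 a.2 ∧ Sat E s a.1 a.2}

lemma TT_disj : ∀ a ∈ TT E s, ∀ b ∈ TT E s, ∀ x, x ∈ cell a.1 a.2 → x ∈ cell b.1 b.2 → a = b := by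
  have key : ∀ a ∈ TT E s, ∀ b ∈ TT E s, ∀ x, x ∈ cell a.1 a.2 → x ∈ cell b.1 b.2 →
      ¬ a.1 < b.1 := by
    intro a ha b hb x hxa hxb hlt
    have := hb.1 x hxb a.1 hlt
    rw [show idx a.1 x = a.2 from hxa] at this
    exact this ha.2
  intro a ha b hb x hxa hxb
  have h1 := key a ha b hb x hxa hxb
  have h2 := key b hb a ha x hxb hxa
  have h : a.1 = b.1 := by omega
  refine Prod.ext h ?_
  rw [← (show idx a.1 x = a.2 from hxa), ← (show idx b.1 x = b.2 from hxb), h]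

lemma exists_TT {x : EuclideanSpace ℝ (Fin d)} {n : ℕ} (h : ∃ m ≤ n, Sat E s m (idx m x)) :
    ∃ m ≤ n, (m, idx m x) ∈ TT E s := by
  classical
  have h' : ∃ m, Sat E s m (idx m x) := ⟨h.choose, h.choose_spec.2⟩
  refine ⟨Nat.find h', ?_, ?_, Nat.find_spec h'⟩
  · obtain ⟨m, hm, hs⟩ := h
    exact (Nat.find_min' h' hs).trans hm
  · intro y hy m hm
    have : idx m y = idx m x := idx_nest hm.le hy
    rw [this]
    exact Nat.find_min h' hm

lemma Fr_of_not {x : EuclideanSpace ℝ (Fin d)} {n : ℕ} (h : ¬ ∃ m ≤ n, Sat E s m (idx m x)) :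
    Fr E s n (idx n x) := by
  intro y hy m hm hsat
  rw [idx_nest hm.le (show idx n y = idx n x from hy)] at hsat
  exact h ⟨m, hm.le, hsat⟩

lemma tsum_TT (hs : 0 < s) : ∑' a : TT E s, ell a.1.1 ^ s ≤ MM E s univ := by
  refine le_trans (le_of_eq ?_) (tsum_MM_le hs (TT E s) TT_disj (fun a ha => ha.1) univ
    (fun _ _ => subset_univ _))
  exact tsum_congr fun a => a.2.2.symm

lemma null_compl (hs : 0 < s) (hsd : s < d) (hM : MM E s univ ≠ ⊤) :
    volume (E \ ⋃ a ∈ TT E s, cell a.1 a.2) = 0 := by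
  have key : ∀ k, volume (E \ ⋃ a ∈ TT E s, cell a.1 a.2) ≤ ell k ^ (d - s) * MM E s univ := by
    intro k
    let A : Set (ℕ × (Fin d → ℤ)) := {a | a.1 = k ∧ Fr E s a.1 a.2}
    have h1 := tsum_MM_le (E := E) hs A (by
      intro a ha b hb x hxa hxb
      refine Prod.ext (ha.1.trans hb.1.symm) ?_
      rw [← (show idx a.1 x = a.2 from hxa), ← (show idx b.1 x = b.2 from hxb), ha.1, hb.1])
      (fun a ha => ha.2) univ (fun _ _ => subset_univ _)
    have h2 : E \ ⋃ a ∈ TT E s, cell a.1 a.2 ⊆ ⋃ a : A, E ∩ cell a.1.1 a.1.2 := by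
      rintro x ⟨hxE, hx⟩
      simp only [mem_iUnion, exists_prop, not_exists, not_and] at hx
      have : ¬ ∃ m ≤ k, Sat E s m (idx m x) := by
        intro h
        obtain ⟨m, -, hm⟩ := exists_TT h
        exact hx _ hm rfl
      simp only [mem_iUnion]
      exact ⟨⟨(k, idx k x), rfl, Fr_of_not this⟩, hxE, rfl⟩
    calc _ ≤ ∑' a : A, volume (E ∩ cell a.1.1 a.1.2) := (measure_mono h2).trans (measure_iUnion_le _)
      _ ≤ ∑' a : A, ell k ^ (d - s) * MM E s (cell a.1.1 a.1.2) := by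
          refine ENNReal.tsum_le_tsum fun a => ?_
          have h3 := MM_ge (E := E) hs hsd a.1.1 a.1.2
          calc _ = ell k ^ ((d:ℝ) - s) * (ell a.1.1 ^ (s - d) * volume (E ∩ cell a.1.1 a.1.2)) := by
                rw [← mul_assoc, a.2.1, ← ell_rpow_add]; simp
            _ ≤ _ := by gcongr
      _ = ell k ^ (d - s) * ∑' a : A, MM E s (cell a.1.1 a.1.2) := ENNReal.tsum_mul_left
      _ ≤ _ := by gcongr
  have ht : Tendsto (fun k => ell k ^ ((d:ℝ) - s) * MM E s univ) atTop (nhds (0 * MM E s univ)) :=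
    ENNReal.Tendsto.mul_const (tendsto_ell_rpow (by linarith)) (Or.inr hM)
  rw [zero_mul] at ht
  exact le_antisymm (ge_of_tendsto' ht key) zero_le

lemma exists_big (hs : 0 < s) (hsd : s < d) (hM : MM E s univ ≠ ⊤) {j n : ℕ} {z : Fin d → ℤ}
    (h : ell j ^ (d - s) * ell n ^ (d:ℝ) < volume (E ∩ cell n z)) :
    ∃ a ∈ TT E s, a.1 ≤ n + j ∧ ∃ y ∈ cell a.1 a.2, y ∈ cell n z := by
  by_contra! hcon
  apply h.not_ge
  let A : Set (ℕ × (Fin d → ℤ)) := {a | a ∈ TT E s ∧ ∃ y ∈ cell a.1 a.2, y ∈ cell n z}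
  have hlev : ∀ a ∈ A, n + j < a.1 := by
    rintro a ⟨ha, y, hy, hyn⟩
    by_contra! hle
    exact hcon a ha hle y hy hyn
  have h1 := tsum_MM_le (E := E) hs A (fun a ha b hb => TT_disj a ha.1 b hb.1)
    (fun a ha => ha.1.1) (cell n z) (by
      intro a ha
      have := hlev a ha
      obtain ⟨ha, y, hy, hyn⟩ := ha
      exact cell_subset (by omega) hyn hy)
  have h2 : E ∩ cell n z ⊆ (E \ ⋃ a ∈ TT E s, cell a.1 a.2) ∪ ⋃ a : A, cell a.1.1 a.1.2 := by
    rintro x ⟨hxE, hx⟩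
    by_cases hxT : x ∈ ⋃ a ∈ TT E s, cell a.1 a.2
    · right
      simp only [mem_iUnion, exists_prop] at hxT ⊢
      obtain ⟨a, ha, hxa⟩ := hxT
      exact ⟨⟨a, ha, x, hxa, hx⟩, hxa⟩
    · exact Or.inl ⟨hxE, hxT⟩
  calc _ ≤ 0 + ∑' a : A, volume (cell a.1.1 a.1.2) := by
        refine (measure_mono h2).trans ((measure_union_le _ _).trans ?_)
        rw [null_compl hs hsd hM]
        gcongr
        exact measure_iUnion_le _
    _ ≤ ∑' a : A, ell (n + j) ^ ((d:ℝ) - s) * MM E s (cell a.1.1 a.1.2) := by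
        rw [zero_add]
        refine ENNReal.tsum_le_tsum fun a => (volume_cell_le _ _).trans ?_
        rw [show MM E s (cell a.1.1 a.1.2) = ell a.1.1 ^ s from a.2.1.2]
        calc ell a.1.1 ^ (d:ℝ) = ell a.1.1 ^ ((d:ℝ) - s) * ell a.1.1 ^ s := by
              rw [← ell_rpow_add]; simp
          _ ≤ _ := by
              refine mul_le_mul' (ell_rpow_anti (hlev _ a.2).le (by linarith)) le_rfl
    _ = ell (n + j) ^ ((d:ℝ) - s) * ∑' a : A, MM E s (cell a.1.1 a.1.2) := ENNReal.tsum_mul_left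
    _ ≤ ell (n + j) ^ ((d:ℝ) - s) * ell n ^ s := by
        gcongr
        exact h1.trans (MM_cell_le _ _)
    _ = _ := by
        rw [ell_add, ENNReal.mul_rpow_of_nonneg _ _ (by linarith), mul_comm (ell n ^ _), mul_assoc,
          ← ell_rpow_add]
        simp

def thick (K : ℕ) (a : ℕ × (Fin d → ℤ)) : Set (EuclideanSpace ℝ (Fin d)) :=
  {x | ∃ y ∈ cell a.1 a.2, edist x y ≤ K * ell a.1}

lemma diam_cell_le (n : ℕ) (z : Fin d → ℤ) : Metric.ediam (cell n z) ≤ (2 * d : ℕ) * ell n :=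
  Metric.ediam_le fun _ hx _ hy => edist_le_of_cell hx hy

lemma diam_thick_le (K : ℕ) (a : ℕ × (Fin d → ℤ)) :
    Metric.ediam (thick K a) ≤ (K + 2 * d + K : ℕ) * ell a.1 := by
  refine Metric.ediam_le ?_
  rintro x ⟨x', hx', hx⟩ y ⟨y', hy', hy⟩
  calc edist x y ≤ edist x x' + edist x' y' + edist y' y := edist_triangle4 _ _ _ _
    _ ≤ K * ell a.1 + (2 * d : ℕ) * ell a.1 + K * ell a.1 := by
        gcongr
        · exact edist_le_of_cell hx' hy'
        · rw [edist_comm]; exact hy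
    _ = _ := by push_cast; ring

noncomputable def contentOM (d : ℕ) (s : ℝ) (hs : 0 < s) : OuterMeasure (EuclideanSpace ℝ (Fin d)) :=
  OuterMeasure.ofFunction (fun A => Metric.ediam A ^ s) (by simp [hs])

lemma hContent_eq (hs : 0 < s) (A : Set (EuclideanSpace ℝ (Fin d))) :
    hContent s A = contentOM d s hs A := rfl

lemma content_le (hs : 0 < s) (hsd : s < d) (hM : MM E s univ ≠ ⊤)
    (hden : ∀ x ∈ E, ∃ c : ℝ≥0∞, 0 < c ∧ ∀ᶠ n : ℕ in atTop,
      c * ell n ^ (d:ℝ) ≤ volume (E ∩ Metric.ball x ((2⁻¹:ℝ) ^ n))) :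
    hContent s E ≤ ((2 * d : ℕ) : ℝ≥0∞) ^ s * MM E s univ := by
  rw [hContent_eq hs]
  have hcov : E ⊆ (⋃ a : TT E s, closure (cell a.1.1 a.1.2)) ∪
      ⋃ K : ℕ, limsup (fun a : TT E s => thick K a.1) cofinite := by
    intro x hx
    obtain ⟨c, hc, hev⟩ := hden x hx
    have hN0 : ((nbr d).card : ℝ≥0∞) ≠ 0 := by
      simpa using (nbr_card_pos (d := d)).ne_empty
    have hc' : 0 < c / (nbr d).card := ENNReal.div_pos hc.ne' (by simp)
    obtain ⟨j, hj⟩ := ((tendsto_ell_rpow (a := (d:ℝ) - s) (by linarith)).eventually_lt_const hc').exists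
    have hpt : ∀ᶠ n : ℕ in atTop, ∃ a ∈ TT E s, a.1 ≤ n + j ∧ ∃ y ∈ cell a.1 a.2,
        edist x y ≤ (2 * d : ℕ) * ell n := by
      filter_upwards [hev] with n hn
      have : ∃ w ∈ nbr d, ell j ^ (d - s) * ell n ^ (d:ℝ) < volume (E ∩ cell n (idx n x + w)) := by
        by_contra! hcon
        have h1 : volume (E ∩ Metric.ball x ((2⁻¹:ℝ) ^ n)) ≤
            ∑ w ∈ nbr d, volume (E ∩ cell n (idx n x + w)) := by
          refine (measure_mono ?_).trans (measure_biUnion_finset_le _ _)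
          intro y hy
          have := ball_subset_nbr n x hy.2
          simp only [mem_iUnion, exists_prop] at this ⊢
          obtain ⟨w, hw, hyw⟩ := this
          exact ⟨w, hw, hy.1, hyw⟩
        have h2 := hn.trans (h1.trans (Finset.sum_le_sum hcon))
        rw [Finset.sum_const, nsmul_eq_mul] at h2
        apply h2.not_gt
        rw [← mul_assoc]
        refine ENNReal.mul_lt_mul_left (ell_rpow_ne_zero _ _) (ell_rpow_ne_top _ _) ?_
        rw [mul_comm]
        exact ENNReal.mul_lt_of_lt_div hj
      obtain ⟨w, hw, hvol⟩ := this
      obtain ⟨a, ha, hle, y, hya, hy⟩ := exists_big hs hsd hM hvol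
      exact ⟨a, ha, hle, y, hya, edist_le_of_nbr hw hy⟩
    by_contra hnot
    simp only [mem_union, mem_iUnion, not_or, not_exists] at hnot
    obtain ⟨hcl, hlim⟩ := hnot
    have hfin := hlim (2 * d * 2 ^ j)
    rw [cofinite.limsup_set_eq, mem_ofPred_eq, Set.not_infinite] at hfin
    have hclosed : IsClosed (⋃ a ∈ {a : TT E s | x ∈ thick (2 * d * 2 ^ j) a.1},
        closure (cell a.1.1 a.1.2)) := hfin.isClosed_biUnion fun _ _ => isClosed_closure
    have hopen := hclosed.isOpen_compl
    have hxmem : x ∈ (⋃ a ∈ {a : TT E s | x ∈ thick (2 * d * 2 ^ j) a.1},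
        closure (cell a.1.1 a.1.2))ᶜ := by
      simp only [mem_compl_iff, mem_iUnion, not_exists]
      exact fun a _ => hcl a
    obtain ⟨δ, hδ, hball⟩ := EMetric.isOpen_iff.mp hopen x hxmem
    have htend : Tendsto (fun n => ((2 * d : ℕ) : ℝ≥0∞) * ell n) atTop (nhds 0) := by
      have := ENNReal.Tendsto.const_mul (tendsto_ell_rpow (a := 1) one_pos)
        (Or.inr (ENNReal.natCast_ne_top (2 * d)))
      simpa using this
    obtain ⟨n, ⟨a, ha, hle, y, hya, hy⟩, hnδ⟩ := (hpt.and (htend.eventually_lt_const hδ)).exists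
    have hyball : y ∈ Metric.eball x δ := by
      rw [Metric.mem_eball, edist_comm]; exact hy.trans_lt hnδ
    apply hball hyball
    simp only [mem_iUnion]
    refine ⟨⟨a, ha⟩, ⟨y, hya, hy.trans ?_⟩, subset_closure hya⟩
    have h3 : ell n ≤ 2 ^ j * ell a.1 := by
      have h4 : ell n * ell j ≤ ell a.1 := by rw [← ell_add]; exact ell_anti hle
      calc ell n = 2 ^ j * (ell n * ell j) := by
            unfold ell
            rw [mul_left_comm, ← mul_pow, ENNReal.mul_inv_cancel (by simp) (by simp)]; simp
        _ ≤ _ := by gcongr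
    calc _ ≤ ((2 * d : ℕ) : ℝ≥0∞) * (2 ^ j * ell a.1) := by gcongr
      _ = _ := by push_cast; ring
  have hz : contentOM d s hs (⋃ K : ℕ, limsup (fun a : TT E s => thick K a.1) cofinite) = 0 := by
    rw [measure_iUnion_null_iff]
    intro K
    apply measure_limsup_cofinite_eq_zero
    have : ∑' a : TT E s, contentOM d s hs (thick K a.1) ≤
        ∑' a : TT E s, ((K + 2 * d + K : ℕ) : ℝ≥0∞) ^ s * ell a.1.1 ^ s := by
      refine ENNReal.tsum_le_tsum fun a => ?_
      refine (OuterMeasure.ofFunction_le _).trans ?_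
      rw [← ENNReal.mul_rpow_of_nonneg _ _ hs.le]
      exact ENNReal.rpow_le_rpow (diam_thick_le K a.1) hs.le
    refine (this.trans_lt ?_).ne
    rw [ENNReal.tsum_mul_left]
    refine ENNReal.mul_lt_top ?_ ((tsum_TT hs).trans_lt hM.lt_top)
    exact ENNReal.rpow_lt_top_of_nonneg hs.le (ENNReal.natCast_ne_top _)
  calc _ ≤ contentOM d s hs (⋃ a : TT E s, closure (cell a.1.1 a.1.2)) + 0 := by
        rw [← hz]
        exact (measure_mono hcov).trans (measure_union_le _ _)
    _ ≤ ∑' a : TT E s, ((2 * d : ℕ) : ℝ≥0∞) ^ s * ell a.1.1 ^ s := by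
        rw [add_zero]
        refine (measure_iUnion_le _).trans (ENNReal.tsum_le_tsum fun a => ?_)
        refine (OuterMeasure.ofFunction_le _).trans ?_
        rw [← ENNReal.mul_rpow_of_nonneg _ _ hs.le, Metric.ediam_closure]
        exact ENNReal.rpow_le_rpow (diam_cell_le _ _) hs.le
    _ ≤ _ := by
        rw [ENNReal.tsum_mul_left]
        gcongr
        exact tsum_TT hs

lemma exists_subset_volume_eq (hd : 0 < d) {A : Set (EuclideanSpace ℝ (Fin d))} (hA : MeasurableSet A)
    {R : ℝ} (hR : 0 < R) (hAR : A ⊆ Metric.ball 0 R) {v : ℝ≥0∞} (hv : v ≤ volume A) :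
    ∃ F ⊆ A, MeasurableSet F ∧ volume F = v := by
  have : Nonempty (Fin d) := ⟨⟨0, hd⟩⟩
  have hfinb : ∀ r, volume (Metric.ball (0 : EuclideanSpace ℝ (Fin d)) r) ≠ ⊤ :=
    fun r => measure_ball_lt_top.ne
  have hAfin : volume A ≠ ⊤ := ne_top_of_le_ne_top (hfinb R) (measure_mono hAR)
  set g : ℝ → ℝ := fun r => volume.real (A ∩ Metric.ball 0 r) with hg
  set h : ℝ → ℝ := fun r => volume.real (Metric.ball (0 : EuclideanSpace ℝ (Fin d)) r) with hh
  have hcont : ContinuousOn h (Icc 0 R) := by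
    have : ∀ r ∈ Icc 0 R, h r = r ^ d * volume.real (Metric.ball (0 : EuclideanSpace ℝ (Fin d)) 1) := by
      intro r hr
      simp only [hh, Measure.real]
      rw [Measure.addHaar_ball _ _ hr.1, ENNReal.toReal_mul, ENNReal.toReal_ofReal (by have := hr.1; positivity)]
      simp
    refine ContinuousOn.congr ?_ this
    fun_prop
  have hgh : ∀ r r', r ≤ r' → |g r - g r'| ≤ |h r - h r'| := by
    intro r r' hrr
    have hsub := Metric.ball_subset_ball (x := (0 : EuclideanSpace ℝ (Fin d))) hrr
    have e1 : g r ≤ g r' := measureReal_mono (by gcongr) (measure_ne_top_of_subset inter_subset_left hAfin)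
    have e2 : h r ≤ h r' := measureReal_mono hsub (hfinb _)
    have e3 : g r' ≤ g r + volume.real (Metric.ball (0 : EuclideanSpace ℝ (Fin d)) r' \ Metric.ball 0 r) := by
      refine (measureReal_mono ?_ ?_).trans (measureReal_union_le _ _)
      · intro x hx
        by_cases hxr : x ∈ Metric.ball (0 : EuclideanSpace ℝ (Fin d)) r
        · exact Or.inl ⟨hx.1, hxr⟩
        · exact Or.inr ⟨hx.2, hxr⟩
      · refine measure_union_ne_top (measure_ne_top_of_subset inter_subset_left hAfin)
          (measure_ne_top_of_subset sdiff_subset (hfinb r'))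
    rw [measureReal_sdiff hsub Metric.isOpen_ball.measurableSet (hfinb r')] at e3
    rw [abs_of_nonpos (by linarith), abs_of_nonpos (by linarith)]
    change g r' ≤ g r + (h r' - h r) at e3
    linarith
  have hgh' : ∀ r r', |g r - g r'| ≤ |h r - h r'| := by
    intro r r'
    rcases le_total r r' with hl | hl
    · exact hgh r r' hl
    · rw [abs_sub_comm, abs_sub_comm (h r)]; exact hgh r' r hl
  have hgc : ContinuousOn g (Icc 0 R) := by
    rw [Metric.continuousOn_iff] at hcont ⊢
    intro b hb ε hε
    obtain ⟨δ, hδ, H⟩ := hcont b hb ε hε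
    exact ⟨δ, hδ, fun a ha hab => (hgh' a b).trans_lt (H a ha hab)⟩
  have hiv := intermediate_value_Icc hR.le hgc
  have hg0 : g 0 = 0 := by simp [hg]
  have hgR : g R = (volume A).toReal := by
    simp only [hg, Measure.real]; rw [inter_eq_self_of_subset_left hAR]
  have hvt : v ≠ ⊤ := ne_top_of_le_ne_top hAfin hv
  obtain ⟨r, -, hr⟩ := hiv (show v.toReal ∈ Icc (g 0) (g R) from
    ⟨by rw [hg0]; positivity, by rw [hgR]; exact ENNReal.toReal_mono hAfin hv⟩)
  refine ⟨A ∩ Metric.ball 0 r, inter_subset_left, hA.inter Metric.isOpen_ball.measurableSet, ?_⟩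
  rw [← ENNReal.toReal_eq_toReal_iff' (measure_ne_top_of_subset inter_subset_left hAfin) hvt]
  exact hr

lemma exists_F (hs : 0 < s) (hsd : s < d) (hE : MeasurableSet E) {R : ℝ} (hR : 0 < R)
    (hER : E ⊆ Metric.ball 0 R) {μ : Measure (EuclideanSpace ℝ (Fin d))} (hμ : Adm E s μ) :
    ∃ (l : ℝ≥0∞) (F : Set (EuclideanSpace ℝ (Fin d))), l ≠ 0 ∧ l ≠ ⊤ ∧ MeasurableSet F ∧ F ⊆ E ∧
      l * volume F = μ univ ∧ ∀ n z, l * volume (F ∩ cell n z) ≤ ell n ^ s := by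
  have hd : 0 < d := by
    have : (0:ℝ) < d := hs.trans hsd
    exact_mod_cast this
  obtain ⟨⟨c, hc⟩, hcell⟩ := hμ
  set l : ℝ≥0∞ := (c : ℝ≥0∞) + 1 with hl
  have hl0 : l ≠ 0 := by simp [hl]
  have hlt : l ≠ ⊤ := by simp [hl]
  have hN : ∃ N, ell N ^ ((d:ℝ) - s) < l⁻¹ :=
    ((tendsto_ell_rpow (a := (d:ℝ) - s) (by linarith)).eventually_lt_const
      (ENNReal.inv_pos.mpr hlt)).exists
  obtain ⟨N, hN⟩ := hN
  have hex : ∀ z : Fin d → ℤ, ∃ F ⊆ E ∩ cell N z, MeasurableSet F ∧ volume F = μ (cell N z) / l := by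
    intro z
    refine exists_subset_volume_eq hd (hE.inter (measurableSet_cell _ _)) hR
      (inter_subset_left.trans hER) ?_
    refine ENNReal.div_le_of_le_mul ?_
    refine (hc _).trans ?_
    rw [Measure.smul_apply, ENNReal.smul_def, smul_eq_mul,
      Measure.restrict_apply (measurableSet_cell _ _), mul_comm,
      inter_comm]
    gcongr
    simp [hl]
  choose f hfsub hfm hfv using hex
  set F := ⋃ z, f z with hF
  have hFm : MeasurableSet F := MeasurableSet.iUnion hfm
  have hFcell : ∀ z, F ∩ cell N z = f z := by
    intro z
    ext x
    constructor
    · rintro ⟨hx, hxz⟩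
      obtain ⟨w, hw⟩ := mem_iUnion.mp hx
      have h1 : idx N x = w := (hfsub w hw).2
      have h2 : idx N x = z := hxz
      rw [← h2, h1]; exact hw
    · intro hx
      exact ⟨mem_iUnion.mpr ⟨z, hx⟩, (hfsub z hx).2⟩
  have hmap : (l • volume.restrict F).map (idx N) = μ.map (idx N) := by
    refine Measure.ext_of_singleton fun z => ?_
    rw [Measure.map_apply (measurable_idx N) (measurableSet_singleton _),
      Measure.map_apply (measurable_idx N) (measurableSet_singleton _)]
    change (l • volume.restrict F) (cell N z) = μ (cell N z)
    rw [Measure.smul_apply, smul_eq_mul, Measure.restrict_apply (measurableSet_cell _ _), inter_comm,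
      hFcell, hfv]
    exact ENNReal.mul_div_cancel hl0 hlt
  have hagree : ∀ W : Set (Fin d → ℤ), l * volume (F ∩ idx N ⁻¹' W) = μ (idx N ⁻¹' W) := by
    intro W
    have hW : MeasurableSet W := W.to_countable.measurableSet
    have := congrArg (fun ρ => ρ W) hmap
    simp only [Measure.map_apply (measurable_idx N) hW, Measure.smul_apply, smul_eq_mul,
      Measure.restrict_apply (measurable_idx N hW)] at this
    rw [inter_comm]; exact this
  refine ⟨l, F, hl0, hlt, hFm, iUnion_subset fun z => (hfsub z).trans inter_subset_left, ?_, ?_⟩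
  · simpa using hagree univ
  · intro n z
    rcases le_total n N with h | h
    · have : cell n z = idx N ⁻¹' {w | ∃ x ∈ cell n z, idx N x = w} := by
        ext y
        constructor
        · intro hy; exact ⟨y, hy, rfl⟩
        · rintro ⟨x, hx, hxy⟩
          exact (idx_nest h hxy.symm).trans hx
      rw [this, hagree, ← this]
      exact hcell n z
    · calc l * volume (F ∩ cell n z) ≤ l * (ell n ^ ((d:ℝ) - s) * ell n ^ s) := by
            rw [← ell_rpow_add]
            simp only [sub_add_cancel]
            gcongr
            exact (measure_mono inter_subset_right).trans (volume_cell_le _ _)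
        _ ≤ l * (l⁻¹ * ell n ^ s) := by
            refine mul_le_mul' le_rfl (mul_le_mul' ?_ le_rfl)
            exact (ell_rpow_anti h (by linarith)).trans hN.le
        _ = ell n ^ s := by rw [← mul_assoc, ENNReal.mul_inv_cancel hl0 hlt, one_mul]

lemma kernel_le {t : ℝ} (ht : 0 < t) {x y : EuclideanSpace ℝ (Fin d)} (hxy : x ≠ y) :
    edist x y ^ (-t) ≤ 1 + ∑' n : ℕ, ell (n + 1) ^ (-t) *
      (Metric.ball x ((2⁻¹:ℝ) ^ n)).indicator 1 y := by
  classical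
  rcases le_or_gt 1 (edist x y) with h | h
  · refine le_trans ?_ le_self_add
    exact ENNReal.rpow_le_one_of_one_le_of_neg h (by linarith)
  · refine le_trans ?_ le_add_self
    have hpos : 0 < edist x y := edist_pos.mpr hxy
    have hex : ∃ n, ell n ≤ edist x y := by
      have := (tendsto_ell_rpow (a := 1) one_pos).eventually_lt_const hpos
      obtain ⟨n, hn⟩ := this.exists
      exact ⟨n, by simpa using hn.le⟩
    obtain ⟨k, hk⟩ : ∃ k, Nat.find hex = k + 1 := by
      refine Nat.exists_eq_succ_of_ne_zero fun h0 => ?_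
      have := Nat.find_spec hex
      rw [h0] at this
      simp [ell] at this
      exact this.not_gt h
    have h1 := Nat.find_spec hex
    have h2 : edist x y < ell k := not_le.mp (Nat.find_min hex (m := k) (by omega))
    rw [hk] at h1
    refine le_trans ?_ (ENNReal.le_tsum k)
    have hmem : y ∈ Metric.ball x ((2⁻¹:ℝ) ^ k) := by
      rw [Metric.mem_ball, dist_comm]
      rw [ell_eq_ofReal, edist_dist, ENNReal.ofReal_lt_ofReal_iff (by positivity)] at h2
      exact h2
    rw [indicator_of_mem hmem, Pi.one_apply, mul_one, ENNReal.rpow_neg, ENNReal.rpow_neg]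
    exact ENNReal.inv_le_inv.mpr (ENNReal.rpow_le_rpow h1 ht.le)

noncomputable def box (d : ℕ) (R : ℝ) : Finset (Fin d → ℤ) :=
  Fintype.piFinset fun _ => Finset.Icc ⌊-R⌋ ⌊R⌋

noncomputable def C0 (d : ℕ) (R s t : ℝ) : ℝ≥0∞ :=
  (box d R).card + ∑' n : ℕ, ell (n + 1) ^ (-t) * ((nbr d).card * ell n ^ s)

lemma C0_ne_top {R t : ℝ} (hts : t < s) : C0 d R s t ≠ ⊤ := by
  unfold C0
  refine ENNReal.add_ne_top.mpr ⟨by simp, ?_⟩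
  have : ∀ n, ell (n + 1) ^ (-t) * ((nbr d).card * ell n ^ s) =
      ell 1 ^ (-t) * (nbr d).card * ((2⁻¹ : ℝ≥0∞) ^ (s - t)) ^ n := by
    intro n
    rw [← ell_rpow_eq, ell_add, ENNReal.mul_rpow_of_ne_top (ell_ne_top _) (ell_ne_top _),
      sub_eq_neg_add, ell_rpow_add]
    ring
  simp_rw [this]
  rw [ENNReal.tsum_mul_left, ENNReal.tsum_geometric]
  refine ENNReal.mul_ne_top (ENNReal.mul_ne_top (ell_rpow_ne_top _ _) (by simp)) ?_
  rw [ENNReal.inv_ne_top]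
  have : (2⁻¹ : ℝ≥0∞) ^ (s - t) < 1 := ENNReal.rpow_lt_one (by simp) (by linarith)
  exact (tsub_pos_of_lt this).ne'

lemma potential_le {t R : ℝ} (ht : 0 < t) (hd : 0 < d) {l : ℝ≥0∞} {F : Set (EuclideanSpace ℝ (Fin d))}
    (hF : MeasurableSet F) (hFR : F ⊆ Metric.ball 0 R)
    (hcell : ∀ n z, l * volume (F ∩ cell n z) ≤ ell n ^ s) (x : EuclideanSpace ℝ (Fin d)) :
    l * ∫⁻ y, edist x y ^ (-t) ∂(volume.restrict F) ≤ C0 d R s t := by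
  have : Nonempty (Fin d) := ⟨⟨0, hd⟩⟩
  have h1 : ∫⁻ y, edist x y ^ (-t) ∂(volume.restrict F) ≤ ∫⁻ y, (1 + ∑' n : ℕ, ell (n + 1) ^ (-t) *
      (Metric.ball x ((2⁻¹:ℝ) ^ n)).indicator 1 y) ∂(volume.restrict F) := by
    refine lintegral_mono_ae (ae_restrict_of_ae ?_)
    have : ∀ᵐ y ∂(volume : Measure (EuclideanSpace ℝ (Fin d))), y ≠ x := by
      rw [ae_iff]; simp
    filter_upwards [this] with y hy
    exact kernel_le ht hy.symm
  have hmeas : ∀ n : ℕ, Measurable fun y : EuclideanSpace ℝ (Fin d) =>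
      (Metric.ball x ((2⁻¹:ℝ) ^ n)).indicator (1 : EuclideanSpace ℝ (Fin d) → ℝ≥0∞) y :=
    fun n => measurable_one.indicator Metric.isOpen_ball.measurableSet
  have h2 : ∫⁻ y, (1 + ∑' n : ℕ, ell (n + 1) ^ (-t) *
      (Metric.ball x ((2⁻¹:ℝ) ^ n)).indicator 1 y) ∂(volume.restrict F) =
      volume F + ∑' n : ℕ, ell (n + 1) ^ (-t) * volume (F ∩ Metric.ball x ((2⁻¹:ℝ) ^ n)) := by
    rw [lintegral_add_left measurable_const, lintegral_one, Measure.restrict_apply_univ,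
      lintegral_tsum fun n => ((hmeas n).const_mul _).aemeasurable]
    congr 1
    refine tsum_congr fun n => ?_
    rw [lintegral_const_mul _ (hmeas n), lintegral_indicator_one Metric.isOpen_ball.measurableSet,
      Measure.restrict_apply Metric.isOpen_ball.measurableSet, inter_comm]
  have h3 : l * volume F ≤ (box d R).card := by
    have : F ⊆ ⋃ z ∈ box d R, F ∩ cell 0 z := by
      intro y hy
      simp only [mem_iUnion, exists_prop]
      refine ⟨idx 0 y, Fintype.mem_piFinset.mpr fun i => ?_, hy, rfl⟩
      have hy' := hFR hy
      rw [mem_ball_zero_iff] at hy'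
      have h4 := (PiLp.norm_apply_le y i).trans hy'.le
      rw [Real.norm_eq_abs, abs_le] at h4
      simp only [idx, pow_zero, one_mul, Finset.mem_Icc]
      exact ⟨Int.floor_mono h4.1, Int.floor_mono h4.2⟩
    calc _ ≤ l * ∑ z ∈ box d R, volume (F ∩ cell 0 z) := by
          gcongr
          exact (measure_mono this).trans (measure_biUnion_finset_le _ _)
      _ = ∑ z ∈ box d R, l * volume (F ∩ cell 0 z) := Finset.mul_sum _ _ _
      _ ≤ ∑ z ∈ box d R, 1 := by
          refine Finset.sum_le_sum fun z _ => (hcell 0 z).trans ?_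
          simp [ell]
      _ = _ := by simp
  have h4 : ∀ n : ℕ, l * volume (F ∩ Metric.ball x ((2⁻¹:ℝ) ^ n)) ≤ (nbr d).card * ell n ^ s := by
    intro n
    calc _ ≤ l * ∑ w ∈ nbr d, volume (F ∩ cell n (idx n x + w)) := by
          gcongr
          refine (measure_mono ?_).trans (measure_biUnion_finset_le _ _)
          intro y hy
          have := ball_subset_nbr n x hy.2
          simp only [mem_iUnion, exists_prop] at this ⊢
          obtain ⟨w, hw, hyw⟩ := this
          exact ⟨w, hw, hy.1, hyw⟩
      _ = ∑ w ∈ nbr d, l * volume (F ∩ cell n (idx n x + w)) := Finset.mul_sum _ _ _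
      _ ≤ ∑ w ∈ nbr d, ell n ^ s := Finset.sum_le_sum fun w _ => hcell _ _
      _ = _ := by simp
  calc _ ≤ l * (volume F + ∑' n : ℕ, ell (n + 1) ^ (-t) * volume (F ∩ Metric.ball x ((2⁻¹:ℝ) ^ n))) := by
        rw [← h2]; gcongr
    _ = l * volume F + ∑' n : ℕ, ell (n + 1) ^ (-t) * (l * volume (F ∩ Metric.ball x ((2⁻¹:ℝ) ^ n))) := by
        rw [mul_add, ← ENNReal.tsum_mul_left]
        congr 1
        exact tsum_congr fun n => by ring
    _ ≤ _ := by
        unfold C0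
        exact add_le_add h3 (ENNReal.tsum_le_tsum fun n => mul_le_mul' le_rfl (h4 n))

lemma MM_le_Gsup {t R : ℝ} (ht : 0 < t) (hs : 0 < s) (hts : t < s) (hsd : s < d) (hR : 0 < R)
    (hE : MeasurableSet E) (hER : E ⊆ Metric.ball 0 R) :
    MM E s univ ≤ C0 d R s t * Gsup t E := by
  have hd : 0 < d := by
    have : (0:ℝ) < d := hs.trans hsd
    exact_mod_cast this
  refine iSup_le fun μ => ?_
  obtain ⟨l, F, hl0, hlt, hFm, hFE, hmass, hcell⟩ := exists_F hs hsd hE hR hER μ.2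
  rw [← hmass]
  rcases eq_or_ne (volume F) 0 with h0 | h0
  · simp [h0]
  have hFt : volume F ≠ ⊤ :=
    measure_ne_top_of_subset (hFE.trans hER) measure_ball_lt_top.ne
  have hI : l * energy t (volume.restrict F) ≤ C0 d R s t * volume F := by
    unfold energy
    rw [← lintegral_const_mul' _ _ hlt]
    calc _ ≤ ∫⁻ _, C0 d R s t ∂(volume.restrict F) :=
          lintegral_mono fun x => potential_le ht hd hFm (hFE.trans hER) hcell x
      _ = _ := by rw [lintegral_const, Measure.restrict_apply_univ]
  have hG : volume F ^ 2 / energy t (volume.restrict F) ≤ Gsup t E :=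
    le_iSup₂_of_le (f := fun (F : Set (EuclideanSpace ℝ (Fin d)))
      (_ : MeasurableSet F ∧ F ⊆ E ∧ 0 < volume F) =>
        volume F ^ 2 / energy t (volume.restrict F)) F ⟨hFm, hFE, pos_iff_ne_zero.mpr h0⟩ le_rfl
  refine le_trans ?_ (mul_le_mul' le_rfl hG)
  rw [← mul_div_assoc]
  rw [ENNReal.le_div_iff_mul_le]
  · calc l * volume F * energy t (volume.restrict F) =
        (l * energy t (volume.restrict F)) * volume F := by ring
      _ ≤ C0 d R s t * volume F * volume F := by gcongr
      _ = _ := by ring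
  · right
    refine mul_ne_zero ?_ (pow_ne_zero _ h0)
    have : ell (0 + 1) ^ (-t) * ((nbr d).card * ell 0 ^ s) ≤ C0 d R s t := by
      unfold C0
      refine le_trans ?_ le_add_self
      exact ENNReal.le_tsum (f := fun n => ell (n + 1) ^ (-t) * ((nbr d).card * ell n ^ s)) 0
    refine fun h => ?_
    rw [h, nonpos_iff_eq_zero] at this
    have hc : ((nbr d).card : ℝ≥0∞) ≠ 0 := by simpa using (nbr_card_pos (d := d)).ne_empty
    exact mul_ne_zero (ell_rpow_ne_zero _ _) (mul_ne_zero hc (ell_rpow_ne_zero _ _)) this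
  · by_cases hen : energy t (volume.restrict F) = ⊤
    · exfalso
      rw [hen, ENNReal.mul_top hl0, top_le_iff] at hI
      exact ENNReal.mul_ne_top (C0_ne_top hts) hFt hI
    · exact Or.inl hen

end Aux

/-- For `0 < t < s < d` and `R > 0` there is a constant `C > 0` such that
`H^s_∞(E) ≤ C G_t(E)` for every Lebesgue measurable `E ⊆ B(0,R)` all of whose points have
positive Lebesgue density with respect to `E`. -/
theorem stmt17 (d : ℕ) (t s : ℝ) (ht : 0 < t) (hts : t < s) (hsd : s < d)
    (R : ℝ) (hR : 0 < R) :
    ∃ C : ℝ, 0 < C ∧ ∀ E : Set (EuclideanSpace ℝ (Fin d)), MeasurableSet E →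
      E ⊆ Metric.ball 0 R →
      (∀ x ∈ E, 0 < liminf
        (fun r : ℝ => volume (E ∩ Metric.ball x r) / volume (Metric.ball x r))
        (nhdsWithin 0 (Ioi 0))) →
      hContent s E ≤ ENNReal.ofReal C * Gsup t E := by
  have hs : 0 < s := ht.trans hts
  have hdR : (0:ℝ) < d := hs.trans hsd
  have hd : 0 < d := by exact_mod_cast hdR
  set K : ℝ≥0∞ := ((2 * d : ℕ) : ℝ≥0∞) ^ s * C0 d R s t with hK
  have hA0 : ((2 * d : ℕ) : ℝ≥0∞) ^ s ≠ 0 := by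
    have h2 : ((2 * d : ℕ) : ℝ≥0∞) ≠ 0 := by
      simpa using hd.ne'
    exact (ENNReal.rpow_pos (pos_iff_ne_zero.mpr h2) (ENNReal.natCast_ne_top _)).ne'
  have hKt : K ≠ ⊤ := ENNReal.mul_ne_top
    (ENNReal.rpow_lt_top_of_nonneg hs.le (ENNReal.natCast_ne_top _)).ne (C0_ne_top hts)
  refine ⟨K.toReal + 1, by positivity, fun E hE hER hden => ?_⟩
  have hcont : hContent s E ≤ ((2 * d : ℕ) : ℝ≥0∞) ^ s * MM E s univ := by
    by_cases hM : MM E s univ = ⊤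
    · rw [hM, ENNReal.mul_top hA0]; exact le_top
    refine content_le hs hsd hM fun x hx => ?_
    obtain ⟨c, hc0, hc⟩ := exists_between (hden x hx)
    have hev := eventually_lt_of_lt_liminf hc
    set V := volume (Metric.ball (0 : EuclideanSpace ℝ (Fin d)) 1) with hV
    have hV0 : 0 < V := Metric.measure_ball_pos _ _ one_pos
    refine ⟨c * V, ENNReal.mul_pos hc0.ne' hV0.ne', ?_⟩
    have htend : Tendsto (fun n : ℕ => (2⁻¹:ℝ) ^ n) atTop (nhdsWithin 0 (Ioi 0)) := by
      refine tendsto_nhdsWithin_iff.mpr ⟨tendsto_pow_atTop_nhds_zero_of_lt_one (by norm_num)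
        (by norm_num), Eventually.of_forall fun n => ?_⟩
      simp only [mem_Ioi]; positivity
    filter_upwards [htend.eventually hev] with n hn
    have hpos : (0:ℝ) < (2⁻¹:ℝ) ^ n := by positivity
    have hball : volume (Metric.ball x ((2⁻¹:ℝ) ^ n)) = ell n ^ (d:ℝ) * V := by
      rw [Measure.addHaar_ball_of_pos _ _ hpos, ell_eq_ofReal, ENNReal.rpow_natCast,
        ENNReal.ofReal_pow hpos.le]
      simp [hV]
    have h3 := ENNReal.mul_le_of_le_div hn.le
    rw [hball] at h3
    calc _ = c * (ell n ^ (d:ℝ) * V) := by ring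
      _ ≤ _ := h3
  calc hContent s E ≤ ((2 * d : ℕ) : ℝ≥0∞) ^ s * (C0 d R s t * Gsup t E) := by
        refine hcont.trans ?_
        gcongr
        exact MM_le_Gsup ht hs hts hsd hR hE hER
    _ = K * Gsup t E := by rw [hK, mul_assoc]
    _ ≤ _ := by
        gcongr
        rw [ENNReal.ofReal_add (by positivity) (by norm_num), ENNReal.ofReal_toReal hKt]
        exact le_self_add
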